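/- Rigidity of everywhere-positive solutions (the scalar analytic core of the step in the proof of Theorem 3.1 that a complete causal geodesic satisfying the strong energy and generic conditions must contain a pair of conjugate points): let F : ℝ → ℝ satisfy F(t) ≥ 0 for all t, and let z : ℝ → ℝ be twice differentiable with z''(t) = −F(t)·z(t) for all t ∈ ℝ. If z(t) > 0 for all t ∈ ℝ, then z is constant and F(t) = 0 for all t ∈ ℝ. -/

import Mathlib

/-- If `f'` is antitone, the graph of `f` lies below each of its tangent lines. -/
theorem le_tangent_of_antitone_hasDerivAt {f f' : ℝ → ℝ} (hf : ∀ x, HasDerivAt f (f' x) x)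
    (hf' : Antitone f') (c x : ℝ) : f x ≤ f c + f' c * (x - c) := by
  have hcont : Continuous f := continuous_iff_continuousAt.2 fun y => (hf y).continuousAt
  rcases lt_trichotomy x c with h | rfl | h
  · obtain ⟨y, hy, hslope⟩ :=
      exists_hasDerivAt_eq_slope f f' h hcont.continuousOn fun y _ => hf y
    rw [eq_div_iff (sub_ne_zero.2 h.ne')] at hslope
    nlinarith [hf' hy.2.le]
  · simp
  · obtain ⟨y, hy, hslope⟩ :=
      exists_hasDerivAt_eq_slope f f' h hcont.continuousOn fun y _ => hf y
    rw [eq_div_iff (sub_ne_zero.2 h.ne')] at hslope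
    nlinarith [hf' hy.1.le]

/-- A positive function on `ℝ` with antitone derivative has vanishing derivative. -/
theorem hasDerivAt_eq_zero_of_antitone_of_pos {f f' : ℝ → ℝ}
    (hf : ∀ x, HasDerivAt f (f' x) x) (hf' : Antitone f') (hpos : ∀ x, 0 < f x) (c : ℝ) :
    f' c = 0 := by
  by_contra hc
  have h := le_tangent_of_antitone_hasDerivAt hf hf' c (c - f c / f' c)
  have hroot : f c + f' c * (c - f c / f' c - c) = 0 := by
    field_simp
    ring
  exact (hpos _).not_ge (h.trans_eq hroot)

/-- Rigidity of everywhere-positive solutions: if `z'' = -F·z` on all of `ℝ`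
with `F ≥ 0` and `z > 0` everywhere, then `z` is constant and `F ≡ 0`. -/
theorem rigidity_of_positive_solution
    (F z z' : ℝ → ℝ)
    (hF : ∀ t, 0 ≤ F t)
    (hz' : ∀ t, HasDerivAt z (z' t) t)
    (hz'' : ∀ t, HasDerivAt z' (-(F t) * z t) t)
    (hzpos : ∀ t, 0 < z t) :
    (∀ s t, z s = z t) ∧ (∀ t, F t = 0) := by
  have hanti : Antitone z' := antitone_of_hasDerivAt_nonpos hz'' fun t =>
    mul_nonpos_of_nonpos_of_nonneg (neg_nonpos.2 (hF t)) (hzpos t).le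
  have hzero : ∀ t, z' t = 0 := hasDerivAt_eq_zero_of_antitone_of_pos hz' hanti hzpos
  refine ⟨is_const_of_deriv_eq_zero (fun t => (hz' t).differentiableAt)
    fun t => (hz' t).deriv.trans (hzero t), fun t => ?_⟩
  have hderiv : HasDerivAt z' 0 t := by
    rw [show z' = fun _ => 0 from funext hzero]
    exact hasDerivAt_const t 0
  simpa [(hzpos t).ne'] using (hz'' t).unique hderiv
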